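/- (Conjugation by the longest element relates the left Demazure–Lusztig operator to its dual.) Let w_0 ∈ S_n be the longest element, w_0(i) = n+1−i. Then for every integer i with 1 ≤ i ≤ n−1, w_0^L ∘ T_i^L ∘ w_0^L = T_{n−i}^{L,∨} as operators on M, where T_i^L := −δ_i + s_i^L, T_j^{L,∨} := δ_j + s_j^L, and n−i is the index with α_{n−i} = −w_0·α_i. -/

import Mathlib

open MvPolynomial Finset

noncomputable section

/-- The field `F = ℚ(x_1, …, x_n)`, realized as the fraction field of `ℚ[x_1,…,x_n]`,
with variables indexed by `Fin n` (so `x_a`, `1 ≤ a ≤ n`, corresponds to index `a-1`). -/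
abbrev FF (n : ℕ) : Type := FractionRing (MvPolynomial (Fin n) ℚ)

/-- The action of `S_n` on `F` by `ℚ`-algebra automorphisms permuting the variables,
`w · x_i = x_{w(i)}`. -/
noncomputable def wAct {n : ℕ} (w : Equiv.Perm (Fin n)) : FF n ≃+* FF n :=
  IsFractionRing.ringEquivOfRingEquiv (MvPolynomial.renameEquiv ℚ w).toRingEquiv

/-- The variable `x` (with a `Fin n` index) as an element of `F`. -/
noncomputable def xv {n : ℕ} (i : Fin n) : FF n :=
  algebraMap (MvPolynomial (Fin n) ℚ) (FF n) (MvPolynomial.X i)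

/-- The localization model `M`: functions `S_n → F`, with pointwise operations. -/
abbrev MM (n : ℕ) : Type := Equiv.Perm (Fin n) → FF n

/-- The left Weyl action `(w^L f)(u) = w · (f (w⁻¹ u))`. -/
noncomputable def leftW {n : ℕ} (w : Equiv.Perm (Fin n)) (f : MM n) : MM n :=
  fun u => wAct w (f (w⁻¹ * u))

/-- The right Weyl action `(w^R f)(u) = f (u w)`. -/
noncomputable def rightW {n : ℕ} (w : Equiv.Perm (Fin n)) (f : MM n) : MM n :=
  fun u => f (u * w)

/-- The simple transposition `s_i = (i, i+1)` (1-based index `i`, `1 ≤ i ≤ n-1`). -/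
def sref {n : ℕ} (i : ℕ) (h1 : 1 ≤ i) (h2 : i ≤ n - 1) : Equiv.Perm (Fin n) :=
  Equiv.swap ⟨i - 1, by omega⟩ ⟨i, by omega⟩

/-- The simple root `α_i = x_i - x_{i+1}` (1-based index). -/
noncomputable def alf {n : ℕ} (i : ℕ) (h1 : 1 ≤ i) (h2 : i ≤ n - 1) : FF n :=
  xv ⟨i - 1, by omega⟩ - xv ⟨i, by omega⟩

/-- The fixed-point class `ε_w ∈ M`:
`ε_w(u) = ∏_{a<b} (x_{w(b)} - x_{w(a)})` if `u = w`, and `0` otherwise. -/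
noncomputable def eps {n : ℕ} (w : Equiv.Perm (Fin n)) : MM n := fun u =>
  if u = w then
    ∏ p ∈ Finset.univ.filter (fun p : Fin n × Fin n => p.1 < p.2), (xv (w p.2) - xv (w p.1))
  else 0

/-- The equivariant Euler class `e_w = ∏_{a<b} (x_{w(b)} - x_{w(a)})`. -/
noncomputable def euler {n : ℕ} (w : Equiv.Perm (Fin n)) : FF n :=
  ∏ p ∈ Finset.univ.filter (fun p : Fin n × Fin n => p.1 < p.2), (xv (w p.2) - xv (w p.1))

/-- The Poincaré pairing `⟨f, g⟩ = Σ_w f(w) g(w) / e_w`. -/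
noncomputable def pair {n : ℕ} (f g : MM n) : FF n :=
  ∑ w : Equiv.Perm (Fin n), f w * g w / euler w

/-- The right divided difference (BGG) operator `(∂_i f)(v) = (f(v) - f(v s_i)) / (-(v·α_i))`. -/
noncomputable def rdd {n : ℕ} (i : ℕ) (h1 : 1 ≤ i) (h2 : i ≤ n - 1) (f : MM n) : MM n :=
  fun v => (f v - f (v * sref i h1 h2)) / (-(wAct v (alf i h1 h2)))

/-- The left divided difference operator `(δ_i f)(v) = (f(v) - s_i·(f(s_i v))) / α_i`. -/
noncomputable def ldd {n : ℕ} (i : ℕ) (h1 : 1 ≤ i) (h2 : i ≤ n - 1) (f : MM n) : MM n :=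
  fun v => (f v - wAct (sref i h1 h2) (f (sref i h1 h2 * v))) / alf i h1 h2

/-- The left Demazure–Lusztig operator `T_i^L = -δ_i + s_i^L`. -/
noncomputable def tL {n : ℕ} (i : ℕ) (h1 : 1 ≤ i) (h2 : i ≤ n - 1) (f : MM n) : MM n :=
  -(ldd i h1 h2 f) + leftW (sref i h1 h2) f

/-- The dual left Demazure–Lusztig operator `T_i^{L,∨} = δ_i + s_i^L`. -/
noncomputable def tLd {n : ℕ} (i : ℕ) (h1 : 1 ≤ i) (h2 : i ≤ n - 1) (f : MM n) : MM n :=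
  ldd i h1 h2 f + leftW (sref i h1 h2) f

/-- The right Demazure–Lusztig operator `T_i^R = ∂_i - s_i^R`. -/
noncomputable def tR {n : ℕ} (i : ℕ) (h1 : 1 ≤ i) (h2 : i ≤ n - 1) (f : MM n) : MM n :=
  rdd i h1 h2 f - rightW (sref i h1 h2) f

theorem wAct_algebraMap {n : ℕ} (w : Equiv.Perm (Fin n)) (p : MvPolynomial (Fin n) ℚ) :
    wAct w (algebraMap _ (FF n) p) = algebraMap _ (FF n) (rename w p) := by
  simp [wAct]

theorem wAct_xv {n : ℕ} (w : Equiv.Perm (Fin n)) (j : Fin n) : wAct w (xv j) = xv (w j) := by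
  rw [xv, wAct_algebraMap, rename_X, xv]

theorem wAct_mul_apply {n : ℕ} (w v : Equiv.Perm (Fin n)) (x : FF n) :
    wAct (w * v) x = wAct w (wAct v x) := by
  have h : (wAct (w * v) : FF n →+* FF n) = (wAct w : FF n →+* FF n).comp (wAct v) := by
    refine IsLocalization.ringHom_ext (nonZeroDivisors (MvPolynomial (Fin n) ℚ)) ?_
    refine RingHom.ext fun p => ?_
    simp only [RingHom.comp_apply, RingHom.coe_coe, wAct_algebraMap, rename_rename]
    rfl
  exact DFunLike.congr_fun h x

theorem leftW_leftW {n : ℕ} (w v : Equiv.Perm (Fin n)) (f : MM n) :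
    leftW w (leftW v f) = leftW (w * v) f := by
  funext u
  simp only [leftW, wAct_mul_apply, mul_inv_rev, mul_assoc]

theorem leftW_one {n : ℕ} (f : MM n) : leftW 1 f = f := by
  funext u
  have h (x : FF n) : wAct 1 x = x :=
    (wAct 1).injective (by rw [← wAct_mul_apply, one_mul])
  simp only [leftW, h, inv_one, one_mul]

theorem ldd_apply {n : ℕ} (i : ℕ) (h1 : 1 ≤ i) (h2 : i ≤ n - 1) (f : MM n)
    (v : Equiv.Perm (Fin n)) :
    ldd i h1 h2 f v = (f v - leftW (sref i h1 h2) f v) / alf i h1 h2 := by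
  simp only [ldd, leftW, sref, Equiv.swap_inv]

theorem revPerm_mul_self {n : ℕ} : (Fin.revPerm * Fin.revPerm : Equiv.Perm (Fin n)) = 1 := by
  ext j
  simp

theorem rev_pred_index {n i : ℕ} (h1 : 1 ≤ i) (h2 : i ≤ n - 1) :
    Fin.rev (⟨i - 1, by omega⟩ : Fin n) = ⟨n - i, by omega⟩ := by
  ext
  simp only [Fin.val_rev]
  omega

theorem rev_index {n i : ℕ} (h1 : 1 ≤ i) (h2 : i ≤ n - 1) :
    Fin.rev (⟨i, by omega⟩ : Fin n) = ⟨n - i - 1, by omega⟩ := by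
  ext
  simp only [Fin.val_rev]
  omega

theorem wAct_revPerm_alf {n : ℕ} (i : ℕ) (h1 : 1 ≤ i) (h2 : i ≤ n - 1) :
    wAct Fin.revPerm (alf i h1 h2) = -alf (n := n) (n - i) (by omega) (by omega) := by
  simp only [alf, map_sub, wAct_xv, Fin.revPerm_apply, rev_pred_index h1 h2, rev_index h1 h2,
    neg_sub]

theorem revPerm_mul_sref_mul_revPerm {n : ℕ} (i : ℕ) (h1 : 1 ≤ i) (h2 : i ≤ n - 1) :
    Fin.revPerm * (sref i h1 h2 * Fin.revPerm)
      = sref (n := n) (n - i) (by omega) (by omega) := by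
  have h : (Fin.revPerm : Equiv.Perm (Fin n))⁻¹ = Fin.revPerm :=
    inv_eq_of_mul_eq_one_left revPerm_mul_self
  have h' := Equiv.swap_apply_apply (Fin.revPerm : Equiv.Perm (Fin n))
    ⟨i - 1, by omega⟩ ⟨i, by omega⟩
  rw [h, Fin.revPerm_apply, Fin.revPerm_apply, rev_pred_index h1 h2, rev_index h1 h2,
    Equiv.swap_comm, mul_assoc] at h'
  exact h'.symm

/-- Conjugation by the longest element `w_0` (given by `w_0(i) = n+1-i`) relates the left
Demazure–Lusztig operator to its dual: `w_0^L ∘ T_i^L ∘ w_0^L = T_{n-i}^{L,∨}`. -/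
theorem left_DL_conjugation_by_longest_element
    (n : ℕ) (hn : 2 ≤ n) (i : ℕ) (h1 : 1 ≤ i) (h2 : i ≤ n - 1) (f : MM n) :
    leftW Fin.revPerm (tL i h1 h2 (leftW Fin.revPerm f))
      = tLd (n - i) (by omega) (by omega) f := by
  have hf : leftW Fin.revPerm (leftW Fin.revPerm f) = f := by
    rw [leftW_leftW, revPerm_mul_self, leftW_one]
  have hs : leftW Fin.revPerm (leftW (sref i h1 h2) (leftW Fin.revPerm f))
      = leftW (sref (n - i) (by omega) (by omega)) f := by
    rw [leftW_leftW, leftW_leftW, mul_assoc, revPerm_mul_sref_mul_revPerm]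
  funext u
  have hfu := congrFun hf u
  have hsu := congrFun hs u
  rw [leftW] at hfu hsu
  rw [leftW, tL, tLd, Pi.add_apply, Pi.add_apply, Pi.neg_apply, ldd_apply, ldd_apply, map_add,
    map_neg, map_div₀, map_sub, hfu, hsu, wAct_revPerm_alf, div_neg, neg_neg]
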